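/- For λ in the Gårding cone Γ_k and integers n ≥ k > l ≥ 0, the function λ ↦ [σ_k(λ)/σ_l(λ)]^{1/(k-l)} is concave on Γ_k. -/

import Mathlib

/-- The `j`-th elementary symmetric polynomial of `lam ∈ ℝ^n`. -/
def esymm (n j : ℕ) (lam : Fin n → ℝ) : ℝ :=
  ∑ s ∈ Finset.univ.powersetCard j, ∏ i ∈ s, lam i

/-- The Gårding cone `Γ_k = {λ ∈ ℝ^n : σ_i(λ) > 0, 1 ≤ i ≤ k}`. -/
def gardingCone (n k : ℕ) : Set (Fin n → ℝ) :=
  {lam | ∀ i : ℕ, 1 ≤ i → i ≤ k → 0 < esymm n i lam}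

open Polynomial in
theorem splits_derivative_real (p : ℝ[X]) (hp : p.Splits) : (derivative p).Splits := by
  rw [splits_iff_card_roots] at hp ⊢
  have h1 := p.card_roots_le_derivative
  have h2 := p.natDegree_derivative_le
  have h3 := (derivative p).card_roots'
  omega

open Polynomial in
theorem newton_zero_prod (m : Multiset ℝ) :
    2 * ((m.map (fun r => X - C r)).prod.coeff 0 * (m.map (fun r => X - C r)).prod.coeff 2)
      ≤ (m.map (fun r => X - C r)).prod.coeff 1 ^ 2 := by
  induction m using Multiset.induction_on with
  | empty => simp [coeff_one]
  | cons r m ih =>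
    rw [Multiset.map_cons, Multiset.prod_cons]
    generalize (m.map (fun r => X - C r)).prod = q at *
    have e0 : ((X - C r) * q).coeff 0 = - r * q.coeff 0 := by simp [sub_mul]
    have e1 : ((X - C r) * q).coeff 1 = q.coeff 0 - r * q.coeff 1 := by
      simp [sub_mul, coeff_X_mul q 0]
    have e2 : ((X - C r) * q).coeff 2 = q.coeff 1 - r * q.coeff 2 := by
      simp [sub_mul, coeff_X_mul q 1]
    rw [e0, e1, e2]
    nlinarith [mul_le_mul_of_nonneg_left ih (sq_nonneg r), sq_nonneg (q.coeff 0)]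

open Polynomial in
theorem newton_coeff (k : ℕ) : ∀ p : ℝ[X], p.Splits →
    ((k : ℝ) + 2) * (p.coeff k * p.coeff (k + 2)) ≤ ((k : ℝ) + 1) * p.coeff (k + 1) ^ 2 := by
  induction k with
  | zero =>
    intro p hp
    have h := newton_zero_prod p.roots
    rw [hp.eq_prod_roots]
    simp only [coeff_C_mul]
    push_cast
    norm_num
    nlinarith [mul_le_mul_of_nonneg_left h (sq_nonneg p.leadingCoeff)]
  | succ k ih =>
    intro p hp
    have h := ih _ (splits_derivative_real p hp)
    simp only [coeff_derivative] at h
    push_cast at h ⊢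
    have hk : (0 : ℝ) < ((k : ℝ) + 1) * (k + 2) := by positivity
    have e : k + 1 + 2 = k + 2 + 1 := rfl
    have e' : k + 1 + 1 = k + 2 := rfl
    rw [e'] at *
    rw [e]
    refine le_of_mul_le_mul_left ?_ hk
    linarith

/-- elementary symmetric function over a finset -/
def EE {ι : Type*} (s : Finset ι) (j : ℕ) (x : ι → ℝ) : ℝ :=
  ∑ t ∈ s.powersetCard j, ∏ i ∈ t, x i

theorem EE_zero {ι : Type*} (s : Finset ι) (x : ι → ℝ) : EE s 0 x = 1 := by simp [EE]

theorem EE_insert {ι : Type*} [DecidableEq ι] (s : Finset ι) (a : ι) (ha : a ∉ s) (j : ℕ)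
    (x : ι → ℝ) : EE (insert a s) (j + 1) x = EE s (j + 1) x + x a * EE s j x := by
  unfold EE
  rw [Finset.powersetCard_succ_insert ha, Finset.sum_union, Finset.sum_image, Finset.mul_sum]
  · congr 1
    refine Finset.sum_congr rfl fun t ht => ?_
    rw [Finset.prod_insert]
    exact fun h => ha ((Finset.mem_powersetCard.1 ht).1 h)
  · intro t ht u hu h
    have ht' : a ∉ t := fun h => ha ((Finset.mem_powersetCard.1 ht).1 h)
    have hu' : a ∉ u := fun h => ha ((Finset.mem_powersetCard.1 hu).1 h)
    rw [← Finset.erase_insert ht', ← Finset.erase_insert hu', h]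
  · rw [Finset.disjoint_left]
    intro t ht hu
    obtain ⟨u, _, rfl⟩ := Finset.mem_image.1 hu
    exact ha ((Finset.mem_powersetCard.1 ht).1 (Finset.mem_insert_self _ _))

theorem EE_erase {ι : Type*} [DecidableEq ι] (s : Finset ι) (a : ι) (ha : a ∈ s) (j : ℕ)
    (x : ι → ℝ) :
    EE s (j + 1) x = EE (s.erase a) (j + 1) x + x a * EE (s.erase a) j x := by
  rw [← EE_insert _ _ (Finset.notMem_erase a s), Finset.insert_erase ha]

theorem EE_smul {ι : Type*} (s : Finset ι) (j : ℕ) (c : ℝ) (x : ι → ℝ) :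
    EE s j (c • x) = c ^ j * EE s j x := by
  unfold EE
  rw [Finset.mul_sum]
  refine Finset.sum_congr rfl fun t ht => ?_
  simp [Finset.prod_mul_distrib, (Finset.mem_powersetCard.1 ht).2]

theorem EE_one {ι : Type*} (s : Finset ι) (x : ι → ℝ) : EE s 1 x = ∑ i ∈ s, x i := by
  simp [EE, Finset.powersetCard_one]

theorem EE_empty {ι : Type*} (j : ℕ) (x : ι → ℝ) : EE ∅ (j + 1) x = 0 := by
  unfold EE
  rw [Finset.powersetCard_eq_empty.2 (by simp)]; simp

theorem EE_euler {ι : Type*} [DecidableEq ι] (x : ι → ℝ) (s : Finset ι) : ∀ k : ℕ,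
    ((k : ℝ) + 1) * EE s (k + 1) x = ∑ i ∈ s, x i * EE (s.erase i) k x := by
  induction s using Finset.induction_on with
  | empty => intro k; simp [EE_empty]
  | insert a s ha ih =>
    intro k
    cases k with
    | zero => simp [EE_zero, EE_one]
    | succ k =>
      rw [Finset.sum_insert ha, Finset.erase_insert ha]
      have : ∑ i ∈ s, x i * EE ((insert a s).erase i) (k + 1) x
          = ∑ i ∈ s, x i * EE (s.erase i) (k + 1) x
            + x a * ∑ i ∈ s, x i * EE (s.erase i) k x := by
        rw [Finset.mul_sum, ← Finset.sum_add_distrib]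
        refine Finset.sum_congr rfl fun i hi => ?_
        have hne : a ≠ i := fun h => ha (h ▸ hi)
        rw [Finset.erase_insert_of_ne hne, EE_insert _ _ (fun h => ha (Finset.mem_of_mem_erase h))]
        ring
      rw [this, ← ih, ← ih, EE_insert _ _ ha]
      push_cast
      ring

open Polynomial in
theorem EE_newton {ι : Type*} (s : Finset ι) (x : ι → ℝ) (j : ℕ) :
    EE s j x * EE s (j + 2) x ≤ EE s (j + 1) x ^ 2 := by
  by_cases hj : s.card < j + 2
  · have : EE s (j + 2) x = 0 := by
      unfold EE
      rw [Finset.powersetCard_eq_empty.2 hj]; simp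
    rw [this]; nlinarith [sq_nonneg (EE s (j + 1) x)]
  · obtain ⟨k, hk⟩ : ∃ k, s.card = k + (j + 2) := ⟨s.card - (j + 2), by omega⟩
    have hE : ∀ i, EE s i x = (s.val.map x).esymm i := fun i => (Finset.esymm_map_val x s i).symm
    have hc : (s.val.map x).card = k + (j + 2) := by simpa using hk
    have hco : ∀ i, i ≤ k + (j + 2) →
        ((s.val.map x).map (fun r => X + C r)).prod.coeff i
          = (s.val.map x).esymm (k + (j + 2) - i) := by
      intro i hi
      rw [Multiset.prod_X_add_C_coeff _ (by omega), hc]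
    have hs : ((s.val.map x).map (fun r => X + C r)).prod.Splits := by
      refine Splits.multisetProd fun f hf => ?_
      obtain ⟨r, _, rfl⟩ := Multiset.mem_map.1 hf
      exact Splits.X_add_C r
    have h := newton_coeff k _ hs
    rw [hco k (by omega), hco (k + 1) (by omega), hco (k + 2) (by omega),
      show k + (j + 2) - k = j + 2 by omega, show k + (j + 2) - (k + 1) = j + 1 by omega,
      show k + (j + 2) - (k + 2) = j by omega, ← hE, ← hE, ← hE] at h
    have hk0 : (0 : ℝ) ≤ k := Nat.cast_nonneg k
    by_contra! hcon
    have hpos : 0 ≤ EE s (j + 1) x ^ 2 := sq_nonneg _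
    nlinarith

theorem garding_erase {ι : Type*} [DecidableEq ι] (s : Finset ι) (a : ι) (ha : a ∈ s) (x : ι → ℝ)
    (k : ℕ) : (∀ i ≤ k + 1, 0 < EE s i x) → ∀ i ≤ k, 0 < EE (s.erase a) i x := by
  induction k with
  | zero =>
    intro _ i hi
    obtain rfl : i = 0 := by omega
    simp [EE_zero]
  | succ k ih =>
    intro h i hi
    have ih' := ih (fun i hi => h i (by omega))
    rcases Nat.lt_or_ge i (k + 1) with h1 | h1
    · exact ih' i (by omega)
    obtain rfl : i = k + 1 := by omega
    have h0 := ih' k le_rfl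
    have e1 := EE_erase s a ha k x
    have e2 := EE_erase s a ha (k + 1) x
    have p1 := h (k + 1) (by omega)
    have p2 := h (k + 1 + 1) (by omega)
    have hN := EE_newton (s.erase a) x k
    have e : k + 1 + 1 = k + 2 := rfl
    rw [e] at *
    rw [e1] at p1
    rw [e2] at p2
    generalize EE (s.erase a) k x = u at *
    generalize EE (s.erase a) (k + 1) x = v at *
    generalize EE (s.erase a) (k + 2) x = w at *
    by_contra! hv
    nlinarith [mul_pos p2 h0, mul_nonneg (neg_nonneg.2 hv) p1.le]

theorem scalar_superadd (a p b q r : ℝ) (h1 : 0 < a + p) (h2 : 0 < b + q) (hr : p + q ≤ r) :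
    a * p / (a + p) + b * q / (b + q) ≤ (a + b) * r / (a + b + r) := by
  have h3 : 0 < a + b + r := by linarith
  have e1 : a * p / (a + p) = a - a ^ 2 / (a + p) := by field_simp; ring
  have e2 : b * q / (b + q) = b - b ^ 2 / (b + q) := by field_simp; ring
  have e3 : (a + b) * r / (a + b + r) = (a + b) - (a + b) ^ 2 / (a + b + r) := by
    field_simp; ring
  rw [e1, e2, e3]
  have h4 : (a + b) ^ 2 / (a + b + r) ≤ (a + b) ^ 2 / ((a + p) + (b + q)) := by
    apply div_le_div_of_nonneg_left (sq_nonneg _) (by linarith) (by linarith)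
  have h6 : (a + b) ^ 2 / ((a + p) + (b + q)) ≤ a ^ 2 / (a + p) + b ^ 2 / (b + q) := by
    generalize a + p = u at *
    generalize b + q = v at *
    rw [div_add_div _ _ h1.ne' h2.ne', div_le_div_iff₀ (by positivity) (by positivity)]
    nlinarith [sq_nonneg (a * v - b * u)]
  linarith

theorem quot_formula {ι : Type*} [DecidableEq ι] (s : Finset ι) (k : ℕ) (x : ι → ℝ)
    (hx : ∀ i ≤ k + 1, 0 < EE s i x) :
    ((k : ℝ) + 2) * (EE s (k + 2) x / EE s (k + 1) x) =
      ∑ i ∈ s, x i * (EE (s.erase i) (k + 1) x / EE (s.erase i) k x)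
        / (x i + EE (s.erase i) (k + 1) x / EE (s.erase i) k x) := by
  have h := EE_euler x s (k + 1)
  push_cast at h
  have h' : ((k : ℝ) + 2) * EE s (k + 2) x = ∑ i ∈ s, x i * EE (s.erase i) (k + 1) x := by
    rw [← h]; ring
  rw [← mul_div_assoc, h', Finset.sum_div]
  refine Finset.sum_congr rfl fun i hi => ?_
  have h0 := garding_erase s i hi x k hx k le_rfl
  have h1 := hx (k + 1) le_rfl
  have e1 := EE_erase s i hi k x
  have e2 : x i + EE (s.erase i) (k + 1) x / EE (s.erase i) k x
      = EE s (k + 1) x / EE (s.erase i) k x := by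
    rw [e1]; field_simp; ring
  rw [e2]
  field_simp

theorem superadd {ι : Type*} [DecidableEq ι] (k : ℕ) : ∀ (s : Finset ι) (x y : ι → ℝ),
    (∀ i ≤ k, 0 < EE s i x) → (∀ i ≤ k, 0 < EE s i y) →
    (∀ i ≤ k, 0 < EE s i (x + y)) ∧
      EE s (k + 1) x / EE s k x + EE s (k + 1) y / EE s k y
        ≤ EE s (k + 1) (x + y) / EE s k (x + y) := by
  induction k with
  | zero =>
    intro s x y hx hy
    constructor
    · intro i hi
      obtain rfl : i = 0 := by omega
      simp [EE_zero]
    · simp [EE_zero, EE_one, Finset.sum_add_distrib]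
  | succ k ih =>
    intro s x y hx hy
    obtain ⟨i1, i2⟩ := ih s x y (fun i hi => hx i (by omega)) (fun i hi => hy i (by omega))
    have hxy : ∀ i ≤ k + 1, 0 < EE s i (x + y) := by
      intro i hi
      rcases Nat.lt_or_ge i (k + 1) with h1 | h1
      · exact i1 i (by omega)
      obtain rfl : i = k + 1 := by omega
      have a1 := div_pos (hx (k + 1) le_rfl) (hx k (by omega))
      have a2 := div_pos (hy (k + 1) le_rfl) (hy k (by omega))
      have a3 : 0 < EE s (k + 1) (x + y) / EE s k (x + y) := by linarith
      exact (div_pos_iff_of_pos_right (i1 k le_rfl)).1 a3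
    refine ⟨hxy, ?_⟩
    have hk : (0 : ℝ) < (k : ℝ) + 2 := by positivity
    refine le_of_mul_le_mul_left ?_ hk
    have e : k + 1 + 1 = k + 2 := rfl
    rw [e, mul_add, quot_formula s k x hx, quot_formula s k y hy, quot_formula s k _ hxy,
      ← Finset.sum_add_distrib]
    refine Finset.sum_le_sum fun i hi => ?_
    have gx := garding_erase s i hi x k hx
    have gy := garding_erase s i hi y k hy
    have key : ∀ z : ι → ℝ, (∀ i ≤ k + 1, 0 < EE s i z) →
        0 < z i + EE (s.erase i) (k + 1) z / EE (s.erase i) k z := by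
      intro z hz
      have h0 := garding_erase s i hi z k hz k le_rfl
      have h1 := hz (k + 1) le_rfl
      have e1 := EE_erase s i hi k z
      have e2 : z i + EE (s.erase i) (k + 1) z / EE (s.erase i) k z
          = EE s (k + 1) z / EE (s.erase i) k z := by
        rw [e1]; field_simp; ring
      rw [e2]; positivity
    exact scalar_superadd _ _ _ _ _ (key x hx) (key y hy) (ih (s.erase i) x y gx gy).2

theorem geom_superadd (m : ℕ) (hm : 0 < m) (u v w : ℕ → ℝ) (hu : ∀ i < m, 0 < u i)
    (hv : ∀ i < m, 0 < v i) (hw : ∀ i < m, u i + v i ≤ w i) :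
    (∏ i ∈ Finset.range m, u i) ^ ((1 : ℝ) / m) + (∏ i ∈ Finset.range m, v i) ^ ((1 : ℝ) / m)
      ≤ (∏ i ∈ Finset.range m, w i) ^ ((1 : ℝ) / m) := by
  have hm' : (0 : ℝ) < m := by exact_mod_cast hm
  have hwp : ∀ i < m, 0 < w i := fun i hi => by linarith [hu i hi, hv i hi, hw i hi]
  have amgm : ∀ z : ℕ → ℝ, (∀ i < m, 0 < z i) →
      (∏ i ∈ Finset.range m, z i) ^ ((1 : ℝ) / m) / (∏ i ∈ Finset.range m, w i) ^ ((1 : ℝ) / m)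
        ≤ ∑ i ∈ Finset.range m, (1 : ℝ) / m * (z i / w i) := by
    intro z hz
    have h := Real.geom_mean_le_arith_mean_weighted (Finset.range m) (fun _ => (1 : ℝ) / m)
      (fun i => z i / w i) (fun i _ => by positivity) (by simp; field_simp)
      (fun i hi => (div_pos (hz i (Finset.mem_range.1 hi)) (hwp i (Finset.mem_range.1 hi))).le)
    rw [Real.finsetProd_rpow _ _ (fun i hi =>
      (div_pos (hz i (Finset.mem_range.1 hi)) (hwp i (Finset.mem_range.1 hi))).le),
      Finset.prod_div_distrib, Real.div_rpow] at h
    · exact h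
    · exact Finset.prod_nonneg fun i hi => (hz i (Finset.mem_range.1 hi)).le
    · exact Finset.prod_nonneg fun i hi => (hwp i (Finset.mem_range.1 hi)).le
  have hW : 0 < (∏ i ∈ Finset.range m, w i) ^ ((1 : ℝ) / m) :=
    Real.rpow_pos_of_pos (Finset.prod_pos fun i hi => hwp i (Finset.mem_range.1 hi)) _
  rw [← div_le_one hW, add_div]
  refine (add_le_add (amgm u hu) (amgm v hv)).trans ?_
  rw [← Finset.sum_add_distrib]
  have : ∑ i ∈ Finset.range m, (1 : ℝ) / m = 1 := by simp; field_simp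
  refine le_trans ?_ this.le
  refine Finset.sum_le_sum fun i hi => ?_
  have hi := Finset.mem_range.1 hi
  rw [← mul_add, ← add_div]
  have : (u i + v i) / w i ≤ 1 := (div_le_one (hwp i hi)).2 (hw i hi)
  have h1 : (0 : ℝ) < 1 / m := by positivity
  nlinarith

theorem telescope (l m : ℕ) (f : ℕ → ℝ) (hf : ∀ i ≤ l + m, 0 < f i) :
    ∏ i ∈ Finset.range m, f (l + i + 1) / f (l + i) = f (l + m) / f l := by
  induction m with
  | zero => simp [(hf l (by omega)).ne']
  | succ m ih =>
    rw [Finset.prod_range_succ, ih (fun i hi => hf i (by omega))]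
    have h1 := hf (l + m) (by omega)
    have h2 := hf l (by omega)
    rw [show l + (m + 1) = l + m + 1 by omega]
    field_simp

theorem mem_garding_iff (n k : ℕ) (x : Fin n → ℝ) :
    x ∈ gardingCone n k ↔ ∀ i ≤ k, 0 < EE Finset.univ i x := by
  constructor
  · intro h i hi
    rcases Nat.eq_zero_or_pos i with rfl | h0
    · simp [EE_zero]
    · exact h i h0 hi
  · intro h i _ hi
    exact h i hi

/-- For `n ≥ k > l ≥ 0`, the function `λ ↦ (σ_k(λ)/σ_l(λ))^{1/(k-l)}` is concave
on the Gårding cone `Γ_k`. -/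
theorem stmt7 (n k l : ℕ) (hkn : k ≤ n) (hlk : l < k) :
    ConcaveOn ℝ (gardingCone n k)
      (fun lam => (esymm n k lam / esymm n l lam) ^ ((1 : ℝ) / ((k : ℝ) - (l : ℝ)))) := by
  have hsm : ∀ (c : ℝ) (x : Fin n → ℝ), 0 < c → x ∈ gardingCone n k →
      c • x ∈ gardingCone n k := by
    intro c x hc hx
    rw [mem_garding_iff] at hx ⊢
    intro i hi
    rw [EE_smul]
    exact mul_pos (pow_pos hc i) (hx i hi)
  have hadd : ∀ (x y : Fin n → ℝ), x ∈ gardingCone n k → y ∈ gardingCone n k →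
      x + y ∈ gardingCone n k := by
    intro x y hx hy
    rw [mem_garding_iff] at hx hy ⊢
    exact (superadd k Finset.univ x y hx hy).1
  obtain ⟨m, rfl⟩ : ∃ m, k = l + m := ⟨k - l, by omega⟩
  have hm : 0 < m := by omega
  have hm' : (0 : ℝ) < m := by exact_mod_cast hm
  have hexp : ((l + m : ℕ) : ℝ) - (l : ℝ) = m := by push_cast; ring
  rw [hexp]
  have hes : ∀ j x, esymm n j x = EE Finset.univ j x := fun _ _ => rfl
  simp only [hes]
  have hhom : ∀ (c : ℝ) (x : Fin n → ℝ), 0 < c → x ∈ gardingCone n (l + m) →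
      (EE Finset.univ (l + m) (c • x) / EE Finset.univ l (c • x)) ^ ((1 : ℝ) / m)
        = c * (EE Finset.univ (l + m) x / EE Finset.univ l x) ^ ((1 : ℝ) / m) := by
    intro c x hc hx
    rw [mem_garding_iff] at hx
    have h1 := hx (l + m) le_rfl
    have h2 := hx l (by omega)
    rw [EE_smul, EE_smul]
    have : c ^ (l + m) * EE Finset.univ (l + m) x / (c ^ l * EE Finset.univ l x)
        = c ^ m * (EE Finset.univ (l + m) x / EE Finset.univ l x) := by
      rw [pow_add]; field_simp
    rw [this, Real.mul_rpow (by positivity) (by positivity), one_div,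
      Real.pow_rpow_inv_natCast hc.le hm.ne']
  rw [concaveOn_iff_forall_pos]
  constructor
  · rw [convex_iff_forall_pos]
    intro x hx y hy a b ha hb _
    exact hadd _ _ (hsm a x ha hx) (hsm b y hb hy)
  · intro x hx y hy a b ha hb _
    simp only [smul_eq_mul]
    rw [← hhom a x ha hx, ← hhom b y hb hy]
    have hx' := hsm a x ha hx
    have hy' := hsm b y hb hy
    have hxy' := hadd _ _ hx' hy'
    generalize a • x = X at *
    generalize b • y = Y at *
    rw [mem_garding_iff] at hx' hy' hxy'
    rw [← telescope l m (fun i => EE Finset.univ i X) hx',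
      ← telescope l m (fun i => EE Finset.univ i Y) hy',
      ← telescope l m (fun i => EE Finset.univ i (X + Y)) hxy']
    refine geom_superadd m hm _ _ _ ?_ ?_ ?_
    · intro i hi
      exact div_pos (hx' _ (by omega)) (hx' _ (by omega))
    · intro i hi
      exact div_pos (hy' _ (by omega)) (hy' _ (by omega))
    · intro i hi
      exact (superadd (l + i) Finset.univ X Y (fun j hj => hx' j (by omega))
        (fun j hj => hy' j (by omega))).2
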